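/- arXiv:2210.11564 — 5 statements merged into one kernel-verified Lean document; each statement's English description precedes it below -/
import Mathlib

section
/- Let G be a finite group, and let H and K be subgroups of G such that G = HK and every element of H commutes with every element of K (i.e. [H,K] = 1). If x ∈ H, then Sol_G(x) = K·Sol_H(x), i.e. Sol_G(x) = {k·h : k ∈ K, h ∈ H, and the subgroup of G generated by x and h is soluble}. -/
open scoped Pointwise

/-- The solubilizer of an element `x` of a group `G`: the set of all `y ∈ G`
such that the subgroup generated by `x` and `y` is soluble. -/
def solubilizer {G : Type*} [Group G] (x : G) : Set G :=
  {y | IsSolvable ↥(Subgroup.closure ({x, y} : Set G))}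

/-- Multiplying `y` by an element that commutes with both `x` and `y` keeps it in the
solubilizer of `x`. -/
theorem mul_mem_solubilizer_of_commute {G : Type*} [Group G] {x y k : G}
    (hkx : Commute k x) (hky : Commute k y) (hy : y ∈ solubilizer x) :
    k * y ∈ solubilizer x := by
  have hsol : Group.IsSolvable (Subgroup.closure ({x, y} : Set G)) := hy
  have hcent : Subgroup.closure ({x, y} : Set G) ≤ Subgroup.centralizer {k} := by
    rw [Subgroup.closure_le]
    rintro z (rfl | rfl)
    · exact Subgroup.mem_centralizer_singleton_iff.2 hkx.symm.eq
    · exact Subgroup.mem_centralizer_singleton_iff.2 hky.symm.eq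
  let f := MonoidHom.noncommCoprod (Subgroup.closure ({x, y} : Set G)).subtype
    (Subgroup.zpowers k).subtype (by
      rintro ⟨a, ha⟩ ⟨_, n, rfl⟩
      have h : Commute a k := Subgroup.mem_centralizer_singleton_iff.1 (hcent ha)
      exact h.zpow_right n)
  have hzp : Group.IsSolvable (Subgroup.zpowers k) :=
    Group.isSolvable_of_comm fun a b => mul_comm' a b
  have hrange : Group.IsSolvable f.range :=
    Group.isSolvable_of_surjective f.rangeRestrict_surjective
  have hle : Subgroup.closure ({x, k * y} : Set G) ≤ f.range := by
    rw [Subgroup.closure_le]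
    rintro z (rfl | rfl)
    · exact ⟨(⟨z, Subgroup.subset_closure (by simp)⟩, 1), by simp [f]⟩
    · exact ⟨(⟨y, Subgroup.subset_closure (by simp)⟩, ⟨k, Subgroup.mem_zpowers k⟩),
        by simp [f, hky.eq]⟩
  exact Group.isSolvable_of_isSolvable_injective (Subgroup.inclusion_injective hle)

theorem stmt_0 {G : Type*} [Group G] [Finite G] (H K : Subgroup G)
    (hprod : (H : Set G) * (K : Set G) = Set.univ)
    (hcomm : ∀ h ∈ H, ∀ k ∈ K, h * k = k * h)
    (x : G) (hx : x ∈ H) :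
    solubilizer x = (K : Set G) * ((H : Set G) ∩ solubilizer x) := by
  ext y
  constructor
  · intro hy
    obtain ⟨h, hh, k, hk, rfl⟩ : y ∈ (H : Set G) * (K : Set G) := hprod ▸ Set.mem_univ y
    have hhk : Commute h k := hcomm h hh k hk
    have hxk : Commute x k := hcomm x hx k hk
    refine ⟨k, hk, h, ⟨hh, ?_⟩, hhk.symm.eq⟩
    have := mul_mem_solubilizer_of_commute hxk.symm.inv_left
      (hhk.symm.mul_right (Commute.refl k)).inv_left hy
    rwa [show k⁻¹ * (h * k) = h by rw [hhk.eq, inv_mul_cancel_left]] at this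
  · rintro ⟨k, hk, h, ⟨hh, hs⟩, rfl⟩
    exact mul_mem_solubilizer_of_commute (Commute.symm (hcomm x hx k hk))
      (Commute.symm (hcomm h hh k hk)) hs
end

section
/- Let G be a finite group and let x ∈ G be an involution (an element of order 2). If Sol_G(x) is (the underlying set of) a subgroup S of G, then the conjugacy class x^G = {x^g : g ∈ G} is contained in the normal core of S, i.e. in the intersection ⋂_{g ∈ G} g⁻¹Sg. -/
/-- A group generated by two elements of order dividing two is soluble. -/
theorem isSolvable_of_closure_pair_of_mul_self_eq_one {H : Type*} [Group H] {a b : H}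
    (ha : a * a = 1) (hb : b * b = 1) (hab : Subgroup.closure ({a, b} : Set H) = ⊤) :
    Group.IsSolvable H := by
  have ha' : a⁻¹ = a := inv_eq_of_mul_eq_one_left ha
  have hb' : b⁻¹ = b := inv_eq_of_mul_eq_one_left hb
  have conj_mem : ∀ g ∈ ({a, b} : Set H), ∀ n ∈ Subgroup.zpowers (a * b),
      g * n * g⁻¹ ∈ Subgroup.zpowers (a * b) := by
    rintro g hg _ ⟨k, rfl⟩
    have hinv : g * (a * b) * g⁻¹ = (a * b)⁻¹ := by
      rcases hg with rfl | rfl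
      · rw [mul_inv_rev, ha', hb', ← mul_assoc, ha, one_mul]
      · rw [mul_inv_rev, ha', hb', mul_assoc, mul_assoc, hb, mul_one]
    refine ⟨-k, ?_⟩
    simp only [← conj_zpow, hinv, inv_zpow, zpow_neg]
  have normal : (Subgroup.zpowers (a * b)).Normal := by
    constructor
    intro n hn g
    have hg : g ∈ Subgroup.closure ({a, b} : Set H) := hab ▸ Subgroup.mem_top g
    induction hg using Subgroup.closure_induction_left generalizing n with
    | one => simpa using hn
    | mul_left g hg h _ ih =>
      simpa [mul_assoc] using conj_mem g hg _ (ih n hn)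
    | inv_mul_cancel g hg h _ ih =>
      have hginv : g⁻¹ = g := by rcases hg with rfl | rfl <;> assumption
      rw [hginv]
      simpa [mul_assoc] using conj_mem g hg _ (ih n hn)
  have mem_zpowers : ∀ q : H ⧸ Subgroup.zpowers (a * b),
      q ∈ Subgroup.zpowers (a : H ⧸ Subgroup.zpowers (a * b)) := by
    have hle : Subgroup.closure ({a, b} : Set H) ≤
        (Subgroup.zpowers (a : H ⧸ Subgroup.zpowers (a * b))).comap (QuotientGroup.mk' _) := by
      rw [Subgroup.closure_le]
      rintro g (rfl | rfl)
      · exact Subgroup.mem_zpowers _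
      · have hmk : (a : H ⧸ Subgroup.zpowers (a * g)) = g := by
          rw [QuotientGroup.eq, ha']
          exact Subgroup.mem_zpowers _
        exact hmk ▸ Subgroup.mem_zpowers _
    intro q
    obtain ⟨g, rfl⟩ := QuotientGroup.mk_surjective q
    exact hle (hab ▸ Subgroup.mem_top g)
  have : Group.IsSolvable (H ⧸ Subgroup.zpowers (a * b)) := by
    refine Group.isSolvable_of_comm fun p q => ?_
    obtain ⟨m, rfl⟩ := mem_zpowers p
    obtain ⟨n, rfl⟩ := mem_zpowers q
    exact zpow_mul_comm _ m n
  have : Group.IsSolvable (Subgroup.zpowers (a * b)) :=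
    Group.isSolvable_of_comm fun p q => by
      obtain ⟨_, m, rfl⟩ := p
      obtain ⟨_, n, rfl⟩ := q
      exact Subtype.ext (zpow_mul_comm _ m n)
  exact Group.isSolvable_of_ker_le_range (Subgroup.zpowers (a * b)).subtype
    (QuotientGroup.mk' (Subgroup.zpowers (a * b))) (by simp)

/-- The subgroup generated by two elements of order dividing two is soluble. -/
theorem isSolvable_closure_pair_of_mul_self_eq_one {G : Type*} [Group G] {x y : G}
    (hx : x * x = 1) (hy : y * y = 1) :
    Group.IsSolvable (Subgroup.closure ({x, y} : Set G)) := by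
  have hxm : x ∈ Subgroup.closure ({x, y} : Set G) := Subgroup.subset_closure (by simp)
  have hym : y ∈ Subgroup.closure ({x, y} : Set G) := Subgroup.subset_closure (by simp)
  refine isSolvable_of_closure_pair_of_mul_self_eq_one (a := ⟨x, hxm⟩) (b := ⟨y, hym⟩)
    (Subtype.ext hx) (Subtype.ext hy) ?_
  rw [← Subgroup.closure_closure_coe_preimage (k := ({x, y} : Set G))]
  congr 1
  ext z
  simp [Subtype.ext_iff]

theorem stmt_1 {G : Type*} [Group G] [Finite G] (x : G) (hx : orderOf x = 2)
    (S : Subgroup G) (hS : (S : Set G) = solubilizer x) :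
    ∀ g : G, g * x * g⁻¹ ∈ S.normalCore := by
  have hxx : x * x = 1 := by rw [← pow_two, ← hx, pow_orderOf_eq_one]
  intro g h
  have key : ∀ k : G, k * x * k⁻¹ ∈ S := by
    intro k
    rw [← SetLike.mem_coe, hS]
    refine isSolvable_closure_pair_of_mul_self_eq_one hxx ?_
    rw [conj_mul, hxx, mul_one, mul_inv_cancel]
  simpa [mul_assoc] using key (h * g)
end

section
/- Let G be a finite insoluble group and let x be an element of G. Then |Sol_G(x)| ≠ p² for any prime p; that is, the cardinality of Sol_G(x) is never the square of a prime. -/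
open Subgroup in
theorem isSolvable_sup_of_le_normalizer {G : Type*} [Group G] (A B : Subgroup G)
    [hA : Group.IsSolvable A] [hB : Group.IsSolvable B] (h : B ≤ normalizer (A : Set G)) :
    Group.IsSolvable ↥(B ⊔ A) := by
  have := Subgroup.normal_subgroupOf_of_le_normalizer h
  have := Subgroup.normal_subgroupOf_sup_of_le_normalizer h
  let e := QuotientGroup.quotientInfEquivProdNormalizerQuotient B A h
  have h1 : Group.IsSolvable (↥(B ⊔ A) ⧸ A.subgroupOf (B ⊔ A)) :=
    Group.isSolvable_of_surjective (f := e.toMonoidHom) e.surjective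
  have h2 : Group.IsSolvable (A.subgroupOf (B ⊔ A)) :=
    Group.isSolvable_of_isSolvable_injective
      (f := (Subgroup.subgroupOfEquivOfLe (le_sup_right : A ≤ B ⊔ A)).toMonoidHom)
      (Subgroup.subgroupOfEquivOfLe _).injective
  exact Group.isSolvable_of_ker_le_range (A.subgroupOf (B ⊔ A)).subtype
    (QuotientGroup.mk' (A.subgroupOf (B ⊔ A))) (by simp)

section Solubilizer

open Subgroup

variable {G : Type*} [Group G] {x y : G}

theorem mem_solubilizer_of_mem (A : Subgroup G) [Group.IsSolvable A] (hx : x ∈ A) (hy : y ∈ A) :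
    y ∈ solubilizer x := by
  have h : closure {x, y} ≤ A := by
    rw [closure_le]
    rintro z (rfl | rfl) <;> assumption
  exact Group.isSolvable_of_isSolvable_injective (inclusion_injective h)

theorem isSolvable_zpowers (z : G) : Group.IsSolvable (zpowers z) :=
  let _ : CommGroup (zpowers z) := IsMulCommutative.instCommGroup
  inferInstance

theorem mem_solubilizer_of_mem_normalizer (A : Subgroup G) [Group.IsSolvable A] (hx : x ∈ A)
    (hy : y ∈ normalizer (A : Set G)) : y ∈ solubilizer x := by
  have := isSolvable_zpowers y
  have := isSolvable_sup_of_le_normalizer A (zpowers y) (by simpa using hy)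
  exact mem_solubilizer_of_mem (zpowers y ⊔ A) (mem_sup_right hx)
    (mem_sup_left (mem_zpowers y))

theorem mem_solubilizer_of_normalizes (A : Subgroup G) [Group.IsSolvable A] (hy : y ∈ A)
    (hx : x ∈ normalizer (A : Set G)) : y ∈ solubilizer x := by
  have := isSolvable_zpowers x
  have := isSolvable_sup_of_le_normalizer A (zpowers x) (by simpa using hx)
  exact mem_solubilizer_of_mem (zpowers x ⊔ A) (mem_sup_left (mem_zpowers x))
    (mem_sup_right hy)

theorem mem_solubilizer_of_mem_closure {z : G} (hy : y ∈ solubilizer x)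
    (hz : z ∈ closure {x, y}) : z ∈ solubilizer x :=
  have : Group.IsSolvable (closure {x, y}) := hy
  mem_solubilizer_of_mem (closure {x, y}) (subset_closure (by simp)) hz

theorem mul_zpowers_mem_solubilizer {g : G} (hg : g ∈ zpowers x) (hy : y ∈ solubilizer x) :
    y * g ∈ solubilizer x :=
  mem_solubilizer_of_mem_closure hy (mul_mem (subset_closure (by simp))
    ((zpowers_le.2 (subset_closure (by simp)) : zpowers x ≤ closure {x, y}) hg))

theorem zpowers_mul_mem_solubilizer {g : G} (hg : g ∈ zpowers x) (hy : y ∈ solubilizer x) :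
    g * y ∈ solubilizer x :=
  mem_solubilizer_of_mem_closure hy (mul_mem
    ((zpowers_le.2 (subset_closure (by simp)) : zpowers x ≤ closure {x, y}) hg)
    (subset_closure (by simp)))

/-- The left cosets of `⟨x⟩` contained in the solubilizer of `x`, with the action of `⟨x⟩`. -/
def solubilizerCosets (x : G) : SubMulAction (zpowers x) (G ⧸ zpowers x) where
  carrier := (fun g : G => (g : G ⧸ zpowers x)) '' solubilizer x
  smul_mem' := by
    rintro ⟨c, hc⟩ _ ⟨y, hy, rfl⟩
    exact ⟨c * y, zpowers_mul_mem_solubilizer hc hy, rfl⟩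

theorem mk_mem_solubilizerCosets :
    (y : G ⧸ zpowers x) ∈ solubilizerCosets x ↔ y ∈ solubilizer x := by
  refine ⟨?_, fun h => ⟨y, h, rfl⟩⟩
  rintro ⟨z, hz, h⟩
  have := mul_zpowers_mem_solubilizer (QuotientGroup.eq.1 h) hz
  simpa using this

theorem card_solubilizer_eq_mul (x : G) :
    Nat.card (solubilizer x) = Nat.card (zpowers x) * Nat.card (solubilizerCosets x) := by
  have e := QuotientGroup.preimageMkEquivSubgroupProdSet (zpowers x)
    (solubilizerCosets x : Set (G ⧸ zpowers x))
  rw [← Nat.card_prod]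
  refine Nat.card_congr (Equiv.trans (Equiv.setCongr ?_) e)
  ext y
  exact mk_mem_solubilizerCosets.symm

variable [Finite G]

theorem fixedPoints_subset_solubilizerCosets (x : G) :
    MulAction.fixedPoints (zpowers x) (G ⧸ zpowers x) ⊆ solubilizerCosets x := by
  intro q hq
  induction q using QuotientGroup.induction_on with
  | H y =>
    have := isSolvable_zpowers x
    exact mk_mem_solubilizerCosets.2 (mem_solubilizer_of_mem_normalizer (zpowers x)
      (mem_zpowers x) (Sylow.mem_fixedPoints_mul_left_cosets_iff_mem_normalizer.1 hq))

theorem card_fixedPoints_solubilizerCosets (x : G) :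
    Nat.card (MulAction.fixedPoints (zpowers x) (solubilizerCosets x)) =
      Nat.card (normalizer (zpowers x : Set G) ⧸
        (zpowers x).comap (normalizer (zpowers x : Set G)).subtype) := by
  rw [← Nat.card_congr (Sylow.fixedPointsMulLeftCosetsEquivQuotient (zpowers x))]
  refine Nat.card_congr (Equiv.ofBijective
    (fun q => ⟨q.1.1, fun g => congrArg Subtype.val (q.2 g)⟩) ⟨?_, ?_⟩)
  · rintro ⟨⟨a, ha⟩, ha'⟩ ⟨⟨b, hb⟩, hb'⟩ h
    have hab : a = b := congrArg Subtype.val h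
    subst hab
    rfl
  · rintro ⟨a, ha⟩
    exact ⟨⟨⟨a, fixedPoints_subset_solubilizerCosets x ha⟩, fun g => Subtype.ext (ha g)⟩, rfl⟩

theorem prime_sq_dvd_card_of_card_solubilizer {p : ℕ} [hp : Fact p.Prime]
    (h : Nat.card (solubilizer x) = p ^ 2) : p ^ 2 ∣ Nat.card G := by
  have hmul := card_solubilizer_eq_mul x
  rw [h] at hmul
  obtain ⟨k, hk, hxk⟩ := (Nat.dvd_prime_pow hp.out).1 (Dvd.intro _ hmul.symm)
  interval_cases k
  · have hx : x = 1 := by simpa using hxk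
    have hS : solubilizer x = Set.univ := by
      have := isSolvable_zpowers x
      exact Set.eq_univ_of_forall fun y =>
        mem_solubilizer_of_mem_normalizer (zpowers x) (mem_zpowers x) (by
          subst hx
          rw [zpowers_one_eq_bot, normalizer_eq_top]
          trivial)
    rw [hS, Nat.card_univ] at h
    rw [h]
  · have hY : Nat.card (solubilizerCosets x) = p := by
      rw [hxk, pow_one, sq] at hmul
      exact (Nat.eq_of_mul_eq_mul_left hp.out.pos hmul).symm
    have hmod := (IsPGroup.of_card hxk).card_modEq_card_fixedPoints (solubilizerCosets x)
    rw [card_fixedPoints_solubilizerCosets, hY] at hmod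
    have hdvd := (hmod.dvd_iff dvd_rfl).1 dvd_rfl
    refine dvd_trans ?_ (card_subgroup_dvd_card (normalizer (zpowers x : Set G)))
    rw [card_eq_card_quotient_mul_card_subgroup
      ((zpowers x).comap (normalizer (zpowers x : Set G)).subtype), sq]
    refine mul_dvd_mul hdvd (dvd_of_eq ?_)
    rw [← pow_one p, ← hxk]
    exact (Nat.card_congr (subgroupOfEquivOfLe le_normalizer).toEquiv).symm
  · rw [← hxk]
    exact card_subgroup_dvd_card _

theorem exists_sylow_eq_solubilizer {p : ℕ} [hp : Fact p.Prime]
    (h : Nat.card (solubilizer x) = p ^ 2) : ∃ P : Sylow p G, (P : Set G) = solubilizer x := by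
  obtain ⟨k, -, hxk⟩ := (Nat.dvd_prime_pow hp.out).1
    (h ▸ Dvd.intro _ (card_solubilizer_eq_mul x).symm)
  obtain ⟨P, hP⟩ := (IsPGroup.of_card hxk).exists_le_sylow
  have : Group.IsNilpotent P := P.2.isNilpotent
  refine ⟨P, Set.eq_of_subset_of_ncard_le (fun y hy =>
    mem_solubilizer_of_mem (P : Subgroup G) (hP (mem_zpowers x)) hy) ?_ (Set.toFinite _)⟩
  change Nat.card (solubilizer x) ≤ Nat.card P
  rw [h]
  exact Nat.le_of_dvd Nat.card_pos
    (P.pow_dvd_card_of_pow_dvd_card (prime_sq_dvd_card_of_card_solubilizer h))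

end Solubilizer

section Coprime

open Subgroup

variable {G : Type*} [Group G] [Finite G] {p q : ℕ} [Fact p.Prime] [Fact q.Prime]

theorem IsPGroup.exists_sylow_le_normalizer_map {P K : Subgroup G} [K.Normal] (hP : IsPGroup p P)
    (hK : ¬ p ∣ Nat.card K) :
    ∃ S : Sylow q K, P ≤ normalizer ((S : Subgroup K).map K.subtype : Set G) := by
  let _ : MulAction P (Sylow q K) :=
    MulAction.compHom _ ((MulAut.conjNormal (H := K)).comp P.subtype)
  obtain ⟨S, hS⟩ := hP.nonempty_fixed_point_of_prime_not_dvd_card (Sylow q K) fun h =>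
    hK (h.trans ((Sylow.card_dvd_index default).trans (index_dvd_card _)))
  refine ⟨S, fun g hg => ?_⟩
  have hfix : (S : Subgroup K).map (MulAut.conjNormal g : K ≃* K).toMonoidHom = S :=
    congrArg Sylow.toSubgroup (hS ⟨g, hg⟩)
  rw [mem_normalizer_iff_map_conj_eq]
  nth_rw 2 [← hfix]
  rw [map_map, map_map]
  rfl

end Coprime

open Subgroup in
/-- If the solubilizer of `x` is an abelian Sylow subgroup, then the group is soluble. -/
theorem isSolvable_of_abelian_sylow_eq_solubilizer {G : Type*} [Group G] [Finite G] {x : G}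
    {p : ℕ} [Fact p.Prime] (P : Sylow p G) [IsMulCommutative P]
    (hP : (P : Set G) = solubilizer x) : Group.IsSolvable G := by
  have hPsol : Group.IsSolvable P :=
    have : Group.IsNilpotent P := P.2.isNilpotent
    inferInstance
  have hmem : ∀ {y}, y ∈ P ↔ y ∈ solubilizer x := fun {y} => Set.ext_iff.1 hP y
  have hxP : x ∈ P := by
    have := isSolvable_zpowers x
    exact hmem.2 (mem_solubilizer_of_mem (zpowers x) (mem_zpowers x) (mem_zpowers x))
  have hN : normalizer (P : Set G) ≤ centralizer (P : Set G) := fun y hy =>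
    le_centralizer (P : Subgroup G)
      (hmem.2 (mem_solubilizer_of_mem_normalizer (P : Subgroup G) hxP hy))
  set K := (MonoidHom.transferSylow P hN).ker
  have hK1 : Nat.card K = 1 := by
    by_contra hne
    have : Fact (Nat.card K).minFac.Prime := ⟨Nat.minFac_prime hne⟩
    obtain ⟨S, hS⟩ := P.2.exists_sylow_le_normalizer_map (q := (Nat.card K).minFac)
      (MonoidHom.not_dvd_card_ker_transferSylow P hN)
    refine S.ne_bot_of_dvd_card (Nat.minFac_dvd _) ((eq_bot_iff_forall _).2 fun k hk => ?_)
    have : Group.IsNilpotent S := S.2.isNilpotent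
    have : Group.IsSolvable ((S : Subgroup K).map K.subtype) :=
      Group.isSolvable_of_surjective
        (K.subtype.subgroupMap_surjective (S : Subgroup K))
    have hkP : (k : G) ∈ P := hmem.2 (mem_solubilizer_of_normalizes
      ((S : Subgroup K).map K.subtype) (mem_map_of_mem K.subtype hk) (hS hxP))
    exact Subtype.ext (disjoint_def.1
      (MonoidHom.ker_transferSylow_disjoint P hN P P.2) k.2 hkP)
  have hcompl := MonoidHom.ker_transferSylow_isComplement' P hN
  rw [show (MonoidHom.transferSylow P hN).ker = ⊥ from K.eq_bot_of_card_eq hK1,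
    isComplement'_bot_left] at hcompl
  have : Group.IsSolvable (⊤ : Subgroup G) := hcompl ▸ hPsol
  exact Group.isSolvable_of_surjective (f := (topEquiv (G := G)).toMonoidHom) topEquiv.surjective

theorem stmt_6 {G : Type*} [Group G] [Finite G] (hG : ¬ IsSolvable G)
    (x : G) (p : ℕ) (hp : p.Prime) :
    Nat.card (solubilizer x) ≠ p ^ 2 := by
  intro h
  have : Fact p.Prime := ⟨hp⟩
  obtain ⟨P, hP⟩ := exists_sylow_eq_solubilizer h
  have hcard : Nat.card P = p ^ 2 := by
    rw [← h, ← hP]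
    rfl
  have : IsMulCommutative P := IsPGroup.isMulCommutative_of_card_eq_prime_sq hcard
  exact hG (isSolvable_of_abelian_sylow_eq_solubilizer P hP)
end

section
/- Let G be a finite insoluble group and let x ∈ G. If |Sol_G(x)| = 16, then Sol_G(x) is the underlying set of a subgroup of G. -/
open Subgroup

/-- A finite `p`-group is soluble. -/
theorem isSolvable_of_card_prime_pow {G : Type*} [Group G] [Finite G] {p n : ℕ} (hp : p.Prime)
    (h : Nat.card G = p ^ n) : Group.IsSolvable G := by
  have := Fact.mk hp
  have := (IsPGroup.of_card h).isNilpotent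
  infer_instance

theorem isSolvable_of_card_dvd_eight {G : Type*} [Group G] [Finite G]
    (h : Nat.card G ∣ 8) : Group.IsSolvable G := by
  obtain ⟨k, -, hk⟩ := (Nat.dvd_prime_pow Nat.prime_two (m := 3)).1 h
  exact isSolvable_of_card_prime_pow Nat.prime_two hk

/-- A group is soluble if a soluble subgroup `H` exists for which the symmetric group on the
cosets of `H` is soluble. -/
theorem isSolvable_of_isSolvable_perm_quotient {G : Type*} [Group G] (H : Subgroup G)
    [Group.IsSolvable H] [Group.IsSolvable (Equiv.Perm (G ⧸ H))] : Group.IsSolvable G := by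
  refine Group.isSolvable_of_ker_le_range H.subtype (MulAction.toPermHom G (G ⧸ H)) ?_
  rw [← normalCore_eq_ker, range_subtype]
  exact H.normalCore_le

theorem isSolvable_of_index_le_three {G : Type*} [Group G] [Finite G] (H : Subgroup G)
    [Group.IsSolvable H] (h : H.index ≤ 3) : Group.IsSolvable G := by
  have : IsZGroup (Equiv.Perm (G ⧸ H)) := by
    apply IsZGroup.of_squarefree
    rw [Nat.card_perm, ← Subgroup.index_eq_card]
    generalize H.index = n at h
    have h1 : Squarefree 1 := squarefree_one
    have h2 : Squarefree 2 := Nat.prime_two.prime.squarefree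
    have h6 : Squarefree (2 * 3) :=
      (Nat.squarefree_mul (by norm_num)).2 ⟨h2, Nat.prime_three.prime.squarefree⟩
    interval_cases n <;> assumption
  exact isSolvable_of_isSolvable_perm_quotient H

theorem isSolvable_of_index_le_four {G : Type*} [Group G] [Finite G] (H : Subgroup G)
    [Group.IsSolvable H] (h : H.index ≤ 4) : Group.IsSolvable G := by
  rcases h.lt_or_eq with h | h
  · exact isSolvable_of_index_le_three H (by omega)
  have : Group.IsSolvable (Equiv.Perm (G ⧸ H)) := by
    have hc : Nat.card (Equiv.Perm (G ⧸ H)) = 24 := by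
      rw [Nat.card_perm, ← Subgroup.index_eq_card, h]; rfl
    obtain ⟨Q, hQ⟩ := Sylow.exists_subgroup_card_pow_prime (G := Equiv.Perm (G ⧸ H)) 2 (n := 3)
      (by rw [hc]; norm_num)
    have := isSolvable_of_card_prime_pow Nat.prime_two hQ
    refine isSolvable_of_index_le_three Q ?_
    have := Q.card_mul_index
    rw [hQ, hc] at this
    omega
  exact isSolvable_of_isSolvable_perm_quotient H

/-- A finite group with a soluble normal subgroup of index dividing eight is soluble. -/
theorem isSolvable_of_normal_of_index_dvd_eight {G : Type*} [Group G] [Finite G] (N : Subgroup G)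
    [N.Normal] [Group.IsSolvable N] (h : N.index ∣ 8) : Group.IsSolvable G := by
  rw [Group.isSolvable_iff_subgroup_quotient N]
  exact ⟨inferInstance, isSolvable_of_card_dvd_eight h⟩

theorem isSolvable_of_card_eq_mul_prime_pow {G : Type*} [Group G] [Finite G] {m p b : ℕ}
    (hp : p.Prime) (hp2 : p ≠ 2) (hm : m ∣ 8) (hb : p = 7 → b = 1)
    (h : Nat.card G = m * p ^ b) : Group.IsSolvable G := by
  have := Fact.mk hp
  have hm0 : m ≠ 0 := by rintro rfl; simp at hm
  have hpm : ¬ p ∣ m := fun h' => hp2 <|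
    (Nat.prime_dvd_prime_iff_eq hp Nat.prime_two).1 (hp.dvd_of_dvd_pow (h'.trans hm : p ∣ 2 ^ 3))
  let Q : Sylow p G := default
  have hQ : Nat.card Q = p ^ b := by
    rw [Q.card_eq_multiplicity, h, Nat.factorization_mul hm0 (pow_ne_zero _ hp.ne_zero)]
    simp [Nat.factorization_eq_zero_of_not_dvd hpm, hp.factorization_self]
  have hQs : Group.IsSolvable Q := isSolvable_of_card_prime_pow hp hQ
  have hQi : (Q : Subgroup G).index = m := by
    have := (Q : Subgroup G).card_mul_index
    rw [hQ, h, mul_comm] at this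
    exact Nat.eq_of_mul_eq_mul_right (pow_pos hp.pos b) this
  set N := normalizer ((Q : Subgroup G) : Set G) with hN
  have hQN : (Q : Subgroup G) ≤ N := le_normalizer
  have hNi : N.index ∣ 8 := ((index_dvd_of_le hQN).trans hQi.dvd).trans hm
  have hNs : Group.IsSolvable N := by
    have : Group.IsSolvable ((Q : Subgroup G).subgroupOf N) :=
      Group.isSolvable_of_isSolvable_injective
        (f := (subgroupOfEquivOfLe hQN).toMonoidHom) (subgroupOfEquivOfLe hQN).injective
    refine isSolvable_of_normal_of_index_dvd_eight ((Q : Subgroup G).subgroupOf N) ?_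
    exact ((relIndex_dvd_index_of_le hQN).trans hQi.dvd).trans hm
  by_cases h4 : N.index ≤ 4
  · exact isSolvable_of_index_le_four N h4
  have hN8 : N.index = 8 := by
    have := Nat.le_of_dvd (by norm_num) hNi
    interval_cases h' : N.index <;> omega
  have hm8 : m = 8 := Nat.dvd_antisymm hm (hN8 ▸ hQi ▸ index_dvd_of_le hQN)
  have hp7 : p = 7 := by
    have h1 := card_sylow_modEq_one p G
    have h2 : Nat.card (Sylow p G) = N.index := Q.card_eq_index_normalizer
    rw [h2, hN8] at h1
    have := (Nat.modEq_iff_dvd' (by norm_num)).1 h1.symm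
    exact (Nat.prime_dvd_prime_iff_eq hp (by norm_num)).1 this
  obtain rfl := hb hp7
  have hNQ : N = Q := by
    symm
    refine eq_of_le_of_card_ge hQN ?_
    have := N.card_mul_index
    rw [hQ, pow_one]
    rw [hN8, h, pow_one, hm8] at this
    omega
  have hcomm : normalizer ((Q : Subgroup G) : Set G) ≤ centralizer ((Q : Subgroup G) : Set G) := by
    rw [← hN, hNQ]
    have : IsCyclic Q := isCyclic_of_prime_card (hQ.trans (pow_one p))
    exact le_centralizer_iff_isMulCommutative.2 inferInstance
  have hK := MonoidHom.ker_transferSylow_isComplement' Q hcomm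
  have hKc := hK.card_mul_card
  set K := (MonoidHom.transferSylow Q hcomm).ker
  rw [Group.isSolvable_iff_subgroup_quotient K]
  have hKi : Nat.card (G ⧸ K) = p ^ 1 := by rw [← hQ]; exact hK.symm.index_eq_card
  refine ⟨isSolvable_of_card_dvd_eight ?_, isSolvable_of_card_prime_pow hp hKi⟩
  rw [hQ, h] at hKc
  exact (Nat.eq_of_mul_eq_mul_right (pow_pos hp.pos 1) hKc) ▸ hm

theorem mem_solubilizer_iff {G : Type*} [Group G] {x y : G} :
    y ∈ solubilizer x ↔ Group.IsSolvable (closure ({x, y} : Set G)) := Iff.rfl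

theorem isSolvable_of_le {G : Type*} [Group G] {H K : Subgroup G} (h : H ≤ K)
    (hK : Group.IsSolvable K) : Group.IsSolvable H :=
  Group.isSolvable_of_isSolvable_injective (inclusion_injective h)

theorem subset_solubilizer {G : Type*} [Group G] {x : G} {H : Subgroup G}
    (hH : Group.IsSolvable H) (hx : x ∈ H) : (H : Set G) ⊆ solubilizer x := fun _ hy =>
  mem_solubilizer_iff.2 <| isSolvable_of_le
    ((closure_le H).2 (Set.insert_subset hx (Set.singleton_subset_iff.2 hy))) hH

theorem isSolvable_sup {G : Type*} [Group G] {A H : Subgroup G} (hA : Group.IsSolvable A)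
    (hH : Group.IsSolvable H) (h : A ≤ normalizer (H : Set G)) :
    Group.IsSolvable ↥(A ⊔ H) := by
  have hle : A ⊔ H ≤ normalizer (H : Set G) := sup_le h le_normalizer
  have h1 : (H.subgroupOf (A ⊔ H)).Normal := normal_subgroupOf_of_le_normalizer hle
  have h2 : (H.subgroupOf A).Normal := normal_subgroupOf_of_le_normalizer h
  rw [Group.isSolvable_iff_subgroup_quotient (H.subgroupOf (A ⊔ H))]
  exact ⟨Group.isSolvable_of_isSolvable_injective
      (f := (subgroupOfEquivOfLe (le_sup_right : H ≤ A ⊔ H)).toMonoidHom)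
      (subgroupOfEquivOfLe le_sup_right).injective,
    Group.isSolvable_of_surjective
      (f := (QuotientGroup.quotientInfEquivProdNormalizerQuotient A H h).toMonoidHom)
      (QuotientGroup.quotientInfEquivProdNormalizerQuotient A H h).surjective⟩

theorem isSolvable_zpowers_s11 {G : Type*} [Group G] (x : G) : Group.IsSolvable (zpowers x) :=
  Group.isSolvable_of_comm fun a b => mul_comm' a b

theorem normalizer_zpowers_subset_solubilizer {G : Type*} [Group G] (x : G) :
    (normalizer (zpowers x : Set G) : Set G) ⊆ solubilizer x := fun y hy => by
  have h : Group.IsSolvable ↥(zpowers y ⊔ zpowers x) :=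
    isSolvable_sup (isSolvable_zpowers_s11 y) (isSolvable_zpowers_s11 x) (zpowers_le.2 hy)
  exact subset_solubilizer h (le_sup_right (a := zpowers y) (mem_zpowers x))
    (le_sup_left (b := zpowers x) (mem_zpowers y))

theorem closure_subset_solubilizer {G : Type*} [Group G] {x y : G} (hy : y ∈ solubilizer x) :
    (closure ({x, y} : Set G) : Set G) ⊆ solubilizer x :=
  subset_solubilizer hy (subset_closure (by simp))

theorem zpowers_le_closure_pair {G : Type*} [Group G] (x y : G) :
    zpowers x ≤ closure ({x, y} : Set G) := zpowers_le.2 (subset_closure (by simp))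

/-- The solubilizer of `x` is invariant under conjugation by the normalizer of `⟨x⟩`. -/
theorem conj_mem_solubilizer {G : Type*} [Group G] {x y n : G} (hy : y ∈ solubilizer x)
    (hn : n ∈ normalizer (zpowers x : Set G)) : n * y * n⁻¹ ∈ solubilizer x := by
  have hH : Group.IsSolvable ((closure ({x, y} : Set G)).map (MulAut.conj n).toMonoidHom) := by
    have := mem_solubilizer_iff.1 hy
    exact Group.isSolvable_of_surjective
      ((MulAut.conj n).toMonoidHom.subgroupMap_surjective (closure ({x, y} : Set G)))
  refine subset_solubilizer hH ?_ ⟨y, subset_closure (by simp), by simp⟩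
  refine ⟨n⁻¹ * x * n, zpowers_le_closure_pair x y ?_, by simp [mul_assoc]⟩
  simpa using (mem_normalizer_iff.1 (inv_mem hn) x).1 (mem_zpowers x)

theorem preimage_image_mk_of_mul_mem {G : Type*} [Group G] {X : Subgroup G} {D : Set G}
    (hr : ∀ d ∈ D, ∀ b ∈ X, d * b ∈ D) :
    (QuotientGroup.mk ⁻¹' ((QuotientGroup.mk : G → G ⧸ X) '' D)) = D := by
  ext d
  constructor
  · rintro ⟨e, he, h⟩
    have := hr e he _ (QuotientGroup.eq.1 h)
    simpa using this
  · exact fun h => ⟨d, h, rfl⟩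

/-- A set which is a union of left cosets of `X` has size divisible by `|X|`. -/
theorem card_dvd_of_mul_mem {G : Type*} [Group G] {X : Subgroup G} {D : Set G}
    (hr : ∀ d ∈ D, ∀ b ∈ X, d * b ∈ D) : Nat.card X ∣ Nat.card D := by
  rw [← preimage_image_mk_of_mul_mem hr, QuotientGroup.card_preimage_mk]
  exact dvd_mul_right _ _

/-- If `D` is a union of double cosets of a `p`-subgroup `X` and does not meet the normalizer
of `X`, then its size is divisible by `p * |X|`. -/
theorem prime_mul_card_dvd_of_mul_mem {G : Type*} [Group G] [Finite G] {p : ℕ} [Fact p.Prime]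
    {X : Subgroup G} (hX : IsPGroup p X) {D : Set G} (hr : ∀ d ∈ D, ∀ b ∈ X, d * b ∈ D)
    (hl : ∀ d ∈ D, ∀ a ∈ X, a * d ∈ D) (hD : ∀ d ∈ D, d ∉ normalizer (X : Set G)) :
    p * Nat.card X ∣ Nat.card D := by
  let M : SubMulAction X (G ⧸ X) :=
    { carrier := QuotientGroup.mk '' D
      smul_mem' := by
        rintro c _ ⟨d, hd, rfl⟩
        exact ⟨c * d, hl d hd c c.2, rfl⟩ }
  have hM : Nat.card M ≡ Nat.card (MulAction.fixedPoints X M) [MOD p] :=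
    hX.card_modEq_card_fixedPoints M
  have h0 : IsEmpty (MulAction.fixedPoints X M) := by
    refine ⟨fun ⟨⟨q, hq⟩, hf⟩ => ?_⟩
    obtain ⟨d, hd, rfl⟩ := hq
    refine hD d hd (Sylow.mem_fixedPoints_mul_left_cosets_iff_mem_normalizer.1 fun c => ?_)
    exact congrArg Subtype.val (hf c)
  rw [Nat.card_of_isEmpty (α := MulAction.fixedPoints X M)] at hM
  have hc : Nat.card D = Nat.card X * Nat.card M := by
    conv_lhs => rw [← preimage_image_mk_of_mul_mem hr]
    exact QuotientGroup.card_preimage_mk X _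
  rw [hc, mul_comm]
  exact mul_dvd_mul_left _ ((Nat.modEq_zero_iff_dvd).1 hM)

theorem isSolvable_of_card_eq_mul_le_eleven {G : Type*} [Group G] [Finite G] {m k : ℕ}
    (hm : m ∣ 8) (hk : k ≤ 11) (hk2 : ¬ 2 ∣ k) (h : Nat.card G = m * k) :
    Group.IsSolvable G := by
  have key {p b : ℕ} (hp : p.Prime) (hp2 : p ≠ 2) (hb : p = 7 → b = 1) (e : k = p ^ b) :
      Group.IsSolvable G := isSolvable_of_card_eq_mul_prime_pow hp hp2 hm hb (e ▸ h)
  interval_cases k <;> try omega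
  · exact key (p := 3) (b := 0) (by norm_num) (by norm_num) (by norm_num) (by norm_num)
  · exact key (p := 3) (b := 1) (by norm_num) (by norm_num) (by norm_num) (by norm_num)
  · exact key (p := 5) (b := 1) (by norm_num) (by norm_num) (by norm_num) (by norm_num)
  · exact key (p := 7) (b := 1) (by norm_num) (by norm_num) (by norm_num) (by norm_num)
  · exact key (p := 3) (b := 2) (by norm_num) (by norm_num) (by norm_num) (by norm_num)
  · exact key (p := 11) (b := 1) (by norm_num) (by norm_num) (by norm_num) (by norm_num)

theorem mem_normalizer_zpowers {G : Type*} [Group G] [Finite G] {x g : G}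
    (h : g * x * g⁻¹ ∈ zpowers x) : g ∈ normalizer (zpowers x : Set G) := by
  refine mem_normalizer_fintype fun n hn => ?_
  obtain ⟨k, rfl⟩ := mem_zpowers_iff.1 hn
  rw [← conj_zpow]
  exact zpow_mem h k

theorem eq_solubilizer_of_card_le {G : Type*} [Group G] [Finite G] {x : G} {H : Subgroup G}
    (hH : (H : Set G) ⊆ solubilizer x) (h : Nat.card (solubilizer x) ≤ Nat.card H) :
    (H : Set G) = solubilizer x :=
  Set.eq_of_subset_of_ncard_le hH h

/-- If the complement of the normalizer of `⟨x⟩` in the solubilizer of `x` has the size of a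
single double coset of `⟨x⟩`, then a larger soluble subgroup contains this normalizer. -/
theorem exists_normalizer_lt_isSolvable {G : Type*} [Group G] [Finite G] {x : G}
    (hN : Group.IsSolvable (normalizer (zpowers x : Set G)))
    (hc : (solubilizer x \ normalizer (zpowers x : Set G)).ncard = 2 * orderOf x) :
    ∃ T : Subgroup G, normalizer (zpowers x : Set G) < T ∧ Group.IsSolvable T := by
  set N := normalizer (zpowers x : Set G) with hNdef
  have hXN : zpowers x ≤ N := le_normalizer
  obtain ⟨y, hyS, hyN⟩ : (solubilizer x \ (N : Set G)).Nonempty := by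
    rw [← Set.ncard_pos, hc]
    have := orderOf_pos x
    omega
  set H := closure ({x, y} : Set G) with hH
  have hxH : zpowers x ≤ H := zpowers_le_closure_pair x y
  have hyH : y ∈ H := subset_closure (by simp)
  have hHS : (H : Set G) ⊆ solubilizer x := closure_subset_solubilizer hyS
  have hDH : solubilizer x \ (N : Set G) ⊆ H := by
    have hx (z : G) : ((z * ·) '' (zpowers x : Set G)).ncard = orderOf x := by
      rw [Set.ncard_image_of_injective _ (mul_right_injective z)]
      exact Nat.card_zpowers x
    have hdis : Disjoint ((y * ·) '' (zpowers x : Set G))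
        ((x * y * ·) '' (zpowers x : Set G)) := by
      rw [Set.disjoint_left]
      rintro _ ⟨b, hb, rfl⟩ ⟨c, hc, h⟩
      refine hyN ((inv_mem_iff (H := N)).1 (mem_normalizer_zpowers ?_))
      have h' : y⁻¹ * x * y⁻¹⁻¹ = b * c⁻¹ := by
        simp only [mul_assoc] at h
        rw [inv_inv, eq_mul_inv_iff_mul_eq, mul_assoc, mul_assoc, inv_mul_eq_iff_eq_mul, h]
      rw [h']
      exact mul_mem hb (inv_mem hc)
    have hsub : (y * ·) '' (zpowers x : Set G) ∪ (x * y * ·) '' (zpowers x : Set G) ⊆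
        solubilizer x \ (N : Set G) := by
      rintro _ (⟨b, hb, rfl⟩ | ⟨b, hb, rfl⟩)
      · exact ⟨hHS (mul_mem hyH (hxH hb)), fun h => hyN ((mul_mem_cancel_right (hXN hb)).1 h)⟩
      · refine ⟨hHS (mul_mem (mul_mem (hxH (mem_zpowers x)) hyH) (hxH hb)), fun h => hyN ?_⟩
        exact (mul_mem_cancel_left (hXN (mem_zpowers x))).1 ((mul_mem_cancel_right (hXN hb)).1 h)
    rw [← Set.eq_of_subset_of_ncard_le hsub
      (by rw [hc, Set.ncard_union_eq hdis, hx, hx, two_mul])]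
    rintro _ (⟨b, hb, rfl⟩ | ⟨b, hb, rfl⟩)
    · exact mul_mem hyH (hxH hb)
    · exact mul_mem (mul_mem (hxH (mem_zpowers x)) hyH) (hxH hb)
  have hNH : N ≤ normalizer (H : Set G) := by
    intro n hn
    have hle : H ≤ H.comap (MulAut.conj n).toMonoidHom := by
      rw [hH, closure_le]
      rintro z (rfl | rfl)
      · exact hxH ((mem_normalizer_iff.1 hn z).1 (mem_zpowers z))
      · refine hDH ⟨conj_mem_solubilizer hyS hn, fun h => hyN ?_⟩
        exact (mul_mem_cancel_left hn).1 ((mul_mem_cancel_right (inv_mem hn)).1 h)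
    exact mem_normalizer_fintype fun h hh => hle hh
  refine ⟨N ⊔ H, lt_of_le_of_ne le_sup_left fun h => hyN ?_, isSolvable_sup hN hyS hNH⟩
  rw [h]
  exact le_sup_right (a := N) hyH

theorem centralizer_eq_normalizer_zpowers {G : Type*} [Group G] [Finite G] {x : G}
    (hx : orderOf x = 2) : centralizer {x} = normalizer (zpowers x : Set G) := by
  ext g
  rw [mem_centralizer_singleton_iff]
  constructor
  · intro h
    refine mem_normalizer_zpowers ?_
    rw [h, mul_inv_cancel_right]
    exact mem_zpowers x
  · intro h
    have h1 := (mem_normalizer_iff.1 h x).1 (mem_zpowers x)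
    obtain ⟨k, hk⟩ := mem_zpowers_iff.1 h1
    rw [← zpow_mod_orderOf, hx] at hk
    rcases Int.emod_two_eq_zero_or_one k with h2 | h2
    · have h3 : x = 1 := by simpa [h2, eq_comm] using hk
      simp [h3] at hx
    · simpa [h2, eq_mul_inv_iff_mul_eq, eq_comm] using hk

/-- The solubilizer of an involution contains all involutions. -/
theorem mem_solubilizer_of_mul_self {G : Type*} [Group G] [Finite G] {x t : G} (hx : x * x = 1)
    (ht : t * t = 1) : t ∈ solubilizer x := by
  have h : Group.IsSolvable ↥(zpowers x ⊔ zpowers (x * t)) := by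
    refine isSolvable_sup (isSolvable_zpowers_s11 x) (isSolvable_zpowers_s11 _) (zpowers_le.2 ?_)
    refine mem_normalizer_zpowers ?_
    have h' : x * (x * t) * x⁻¹ = (x * t)⁻¹ := by
      rw [← mul_assoc, hx, one_mul, mul_inv_rev, inv_eq_of_mul_eq_one_left ht]
    rw [h']
    exact inv_mem (mem_zpowers _)
  have hxm : x ∈ zpowers x ⊔ zpowers (x * t) :=
    le_sup_left (a := zpowers x) (mem_zpowers x)
  refine subset_solubilizer h hxm ?_
  have := mul_mem hxm (le_sup_right (a := zpowers x) (mem_zpowers (x * t)))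
  rwa [← mul_assoc, hx, one_mul] at this

/-- A bound for the index of the centralizer of an involution. -/
theorem two_mul_ncard_orbit_add_two_le {G : Type*} [Group G] [Finite G] {x : G}
    (hx : orderOf x = 2) :
    2 * (MulAction.orbit (ConjAct G) x).ncard + 2 ≤
      Nat.card (solubilizer x) + Nat.card (centralizer {x}) := by
  have hxx : x * x = 1 := by rw [← sq, ← hx, pow_orderOf_eq_one]
  set K := MulAction.orbit (ConjAct G) x with hK
  have hKsq : ∀ t ∈ K, t ≠ 1 ∧ t * t = 1 := by
    intro t ht
    obtain ⟨g, rfl⟩ := isConj_iff.1 (ConjAct.mem_orbit_conjAct.1 ht).symm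
    refine ⟨fun h => ?_, by simp [← mul_assoc, mul_assoc _ x x, hxx]⟩
    rw [conj_eq_one_iff] at h
    simp [h] at hx
  have hCS : (centralizer {x} : Set G) ⊆ solubilizer x := by
    rw [centralizer_eq_normalizer_zpowers hx]
    exact normalizer_zpowers_subset_solubilizer x
  have h1 : (K ∩ centralizer {x}).ncard + 1 ≤ Nat.card (centralizer {x}) := by
    have : K ∩ centralizer {x} ⊆ (centralizer {x} : Set G) \ {1} :=
      fun t ht => ⟨ht.2, (hKsq t ht.1).1⟩
    have := Set.ncard_le_ncard this
    have h2 := Set.ncard_sdiff_singleton_add_one (one_mem (centralizer {x})) (Set.toFinite _)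
    have h3 : (centralizer {x} : Set G).ncard = Nat.card (centralizer {x}) := rfl
    omega
  have h2 : 2 * (K \ centralizer {x}).ncard + Nat.card (centralizer {x}) ≤
      Nat.card (solubilizer x) := by
    have hd : (solubilizer x \ (centralizer {x} : Set G)).ncard + Nat.card (centralizer {x}) =
      Nat.card (solubilizer x) := Set.ncard_sdiff_add_ncard_of_subset hCS
    have hdis : Disjoint (K \ centralizer {x}) ((x * ·) '' (K \ centralizer {x})) := by
      rw [Set.disjoint_left]
      rintro _ ⟨hu, hu'⟩ ⟨t, ⟨ht, ht'⟩, rfl⟩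
      refine ht' (mem_centralizer_singleton_iff.2 ?_)
      have h : x * t * (x * t) = 1 := (hKsq _ hu).2
      calc t * x = x * (x * t * (x * t)) * t := by
            rw [mul_assoc x, mul_assoc (x * t), mul_assoc x t t, (hKsq _ ht).2, mul_one,
              ← mul_assoc, ← mul_assoc, hxx, one_mul]
        _ = x * t := by rw [h, mul_one]
    have hsub : (K \ centralizer {x}) ∪ ((x * ·) '' (K \ centralizer {x})) ⊆
        solubilizer x \ (centralizer {x} : Set G) := by
      rintro _ (⟨ht, ht'⟩ | ⟨t, ⟨ht, ht'⟩, rfl⟩)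
      · exact ⟨mem_solubilizer_of_mul_self hxx (hKsq _ ht).2, ht'⟩
      · have htS := mem_solubilizer_of_mul_self hxx (hKsq _ ht).2
        refine ⟨closure_subset_solubilizer htS
          (mul_mem (subset_closure (by simp)) (subset_closure (by simp))), fun h => ht' ?_⟩
        exact (mul_mem_cancel_left (mem_centralizer_singleton_iff.2 rfl)).1 h
    have := Set.ncard_le_ncard hsub
    rw [Set.ncard_union_eq hdis, Set.ncard_image_of_injective _ (mul_right_injective x)] at this
    omega
  have h3 := Set.ncard_inter_add_ncard_sdiff_eq_ncard K (centralizer {x} : Set G)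
  omega

theorem card_orbit_mul_card_centralizer {G : Type*} [Group G] [Finite G] (x : G) :
    (MulAction.orbit (ConjAct G) x).ncard * Nat.card (centralizer {x}) = Nat.card G := by
  rw [nat_card_centralizer_nat_card_stabilizer]
  have := (MulAction.stabilizer (ConjAct G) x).index_mul_card
  rwa [MulAction.index_stabilizer] at this

theorem eq_solubilizer_of_orderOf_eq_two {G : Type*} [Group G] [Finite G]
    (hG : ¬ Group.IsSolvable G) {x : G} (hcard : Nat.card (solubilizer x) = 16)
    (hx : orderOf x = 2) (hc : Nat.card (centralizer {x}) = 4 ∨ Nat.card (centralizer {x}) = 8) :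
    ∃ S : Subgroup G, (S : Set G) = solubilizer x := by
  by_cases h16 : 16 ∣ Nat.card G
  · have hp : IsPGroup 2 (zpowers x) :=
      IsPGroup.of_card (n := 1) (by rw [Nat.card_zpowers, hx]; rfl)
    obtain ⟨P, hP⟩ := hp.exists_le_sylow
    obtain ⟨n, hn⟩ := P.2.exists_card_eq
    refine ⟨P, eq_solubilizer_of_card_le
      (subset_solubilizer (isSolvable_of_card_prime_pow Nat.prime_two hn) (zpowers_le.1 hP)) ?_⟩
    rw [hcard]
    exact Nat.le_of_dvd Nat.card_pos (P.pow_dvd_card_of_pow_dvd_card (n := 4) h16)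
  · exfalso
    apply hG
    have h1 := two_mul_ncard_orbit_add_two_le hx
    have h2 := card_orbit_mul_card_centralizer x
    rw [hcard] at h1
    generalize (MulAction.orbit (ConjAct G) x).ncard = k at h1 h2
    rcases hc with hc | hc <;> rw [hc] at h1 h2
    · by_cases hk : 2 ∣ k
      · obtain ⟨j, rfl⟩ := hk
        exact isSolvable_of_card_eq_mul_le_eleven (m := 8) (k := j) (by norm_num) (by omega)
          (by omega) (by omega)
      · exact isSolvable_of_card_eq_mul_le_eleven (m := 4) (k := k) (by norm_num) (by omega)
          hk (by omega)
    · exact isSolvable_of_card_eq_mul_le_eleven (m := 8) (k := k) (by norm_num) (by omega)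
          (by omega) (by omega)

theorem stmt_11 {G : Type*} [Group G] [Finite G] (hG : ¬ IsSolvable G)
    (x : G) (hcard : Nat.card (solubilizer x) = 16) :
    ∃ S : Subgroup G, (S : Set G) = solubilizer x := by
  set N := normalizer (zpowers x : Set G) with hN
  have hNS : (N : Set G) ⊆ solubilizer x := normalizer_zpowers_subset_solubilizer x
  have hXN : zpowers x ≤ N := le_normalizer
  have hdc : (solubilizer x \ (N : Set G)).ncard + Nat.card N = 16 :=
    (Set.ncard_sdiff_add_ncard_of_subset hNS).trans hcard
  have hr : ∀ d ∈ solubilizer x \ (N : Set G), ∀ b ∈ zpowers x,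
      d * b ∈ solubilizer x \ (N : Set G) := fun d hd b hb =>
    ⟨closure_subset_solubilizer hd.1 (mul_mem (subset_closure (by simp))
      (zpowers_le_closure_pair x d hb)), fun h => hd.2 ((mul_mem_cancel_right (hXN hb)).1 h)⟩
  have hl : ∀ d ∈ solubilizer x \ (N : Set G), ∀ a ∈ zpowers x,
      a * d ∈ solubilizer x \ (N : Set G) := fun d hd a ha =>
    ⟨closure_subset_solubilizer hd.1 (mul_mem (zpowers_le_closure_pair x d ha)
      (subset_closure (by simp))), fun h => hd.2 ((mul_mem_cancel_left (hXN ha)).1 h)⟩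
  have hoN : orderOf x ∣ Nat.card N := Nat.card_zpowers x ▸ card_dvd_of_le hXN
  have hoD : orderOf x ∣ (solubilizer x \ (N : Set G)).ncard :=
    Nat.card_zpowers x ▸ card_dvd_of_mul_mem hr
  obtain ⟨e, he, hoe⟩ := (Nat.dvd_prime_pow Nat.prime_two (m := 4)).1
    (hdc ▸ (hoD.add hoN) : orderOf x ∣ 16)
  have hX : IsPGroup 2 (zpowers x) := IsPGroup.of_card ((Nat.card_zpowers x).trans hoe)
  have h2oD : 2 * orderOf x ∣ (solubilizer x \ (N : Set G)).ncard :=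
    Nat.card_zpowers x ▸ prime_mul_card_dvd_of_mul_mem hX hr hl fun d hd => hd.2
  by_cases hN16 : Nat.card N = 16
  · exact ⟨N, eq_solubilizer_of_card_le hNS (by rw [hcard, hN16])⟩
  have hNpos : 0 < Nat.card N := Nat.card_pos
  have hlarge (h : Group.IsSolvable N)
      (hc : (solubilizer x \ (N : Set G)).ncard = 2 * orderOf x) :
      ∃ T : Subgroup G, (T : Set G) ⊆ solubilizer x ∧ Nat.card T ≤ 16 ∧
        Nat.card N < Nat.card T ∧ Nat.card N ∣ Nat.card T := by
    obtain ⟨T, hNT, hT⟩ := exists_normalizer_lt_isSolvable h hc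
    have hTS := subset_solubilizer hT (hNT.le (hXN (mem_zpowers x)))
    exact ⟨T, hTS, hcard ▸ Set.ncard_le_ncard hTS, Set.ncard_lt_ncard hNT,
      card_dvd_of_le hNT.le⟩
  interval_cases e <;> rw [hoe] at hoN h2oD
  · rw [pow_zero, orderOf_eq_one_iff] at hoe
    have : N = ⊤ := eq_top_iff.2 fun g _ => mem_normalizer_zpowers (by simp [hoe])
    simp [this] at hdc hN16
    exact absurd hdc hN16
  · by_cases h12 : Nat.card N = 12
    · obtain ⟨T, -, h1, h2, h3⟩ := hlarge
        (isSolvable_of_card_eq_mul_le_eleven (m := 4) (k := 3) (by norm_num) (by norm_num)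
          (by norm_num) h12) (by omega)
      rw [h12] at h2 h3
      omega
    · refine eq_solubilizer_of_orderOf_eq_two hG hcard hoe ?_
      rw [centralizer_eq_normalizer_zpowers hoe, ← hN]
      omega
  · have h8 : Nat.card N = 8 := by omega
    obtain ⟨T, hTS, h1, h2, h3⟩ := hlarge (isSolvable_of_card_dvd_eight h8.dvd) (by omega)
    rw [h8] at h2 h3
    exact ⟨T, eq_solubilizer_of_card_le hTS (by omega)⟩
  · omega
  · omega
end

section
/- Let G be a finite insoluble group and suppose that for some x ∈ G the set Sol_G(x) is the underlying set of a 2-subgroup Q of G (a subgroup whose order is a power of 2). Then Q is a Sylow 2-subgroup of G. -/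
theorem self_mem_solubilizer {G : Type*} [Group G] (x : G) : x ∈ solubilizer x := by
  change Group.IsSolvable ↥(Subgroup.closure ({x, x} : Set G))
  rw [Set.pair_eq_singleton, ← Subgroup.zpowers_eq_closure]
  exact Group.isSolvable_of_comm fun a b => Std.Commutative.comm a b

theorem IsPGroup.subset_solubilizer {G : Type*} [Group G] [Finite G] {p : ℕ} [Fact p.Prime]
    {P : Subgroup G} (hP : IsPGroup p P) {x : G} (hx : x ∈ P) :
    (P : Set G) ⊆ solubilizer x := by
  intro y hy
  have hle : Subgroup.closure ({x, y} : Set G) ≤ P :=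
    (Subgroup.closure_le P).2 (Set.pair_subset hx hy)
  have := (hP.to_le hle).isNilpotent
  exact IsNilpotent.to_isSolvable

theorem stmt_13 {G : Type*} [Group G] [Finite G] (hG : ¬ IsSolvable G)
    (x : G) (Q : Subgroup G) (hQ : (Q : Set G) = solubilizer x)
    (h2 : ∃ n : ℕ, Nat.card Q = 2 ^ n) :
    ∃ P : Sylow 2 G, P.toSubgroup = Q := by
  obtain ⟨n, hn⟩ := h2
  obtain ⟨P, hQP⟩ := (IsPGroup.of_card hn).exists_le_sylow
  have hxQ : x ∈ (Q : Set G) := hQ ▸ self_mem_solubilizer x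
  refine ⟨P, le_antisymm ?_ hQP⟩
  rw [← SetLike.coe_subset_coe, hQ]
  exact P.isPGroup'.subset_solubilizer (hQP hxQ)
end
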